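/- arXiv:1311.6794 — 2 statements merged into one kernel-verified Lean document; each statement's English description precedes it below -/
import Mathlib

section
/- Let γ > 0, let f : [0,∞) → ℂ be continuously differentiable with |f'(s)| ≤ Λ for all s ≥ 0, and let x : [0,∞) → ℂ be differentiable with x'(τ) = −γ x(τ) + f(τ) for all τ ≥ 0. Then for every τ ≥ 0, |x(τ) − f(τ)/γ| ≤ e^{−γτ} |x(0) − f(0)/γ| + Λ/γ². (Quasistationary approximation: when f varies slowly relative to the relaxation time 1/γ, the solution is approximately f(τ)/γ.) -/
/-- If `y' = -γ y + h` on `[0,∞)` with `γ > 0` and `‖h‖ ≤ C`, then `y` relaxes exponentially to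
the ball of radius `C / γ`. -/
theorem norm_le_exp_mul_add_of_hasDerivAt_damped {E : Type*} [NormedAddCommGroup E]
    [NormedSpace ℝ E] {γ C : ℝ} (hγ : 0 < γ) {y h : ℝ → E}
    (hy : ∀ t : ℝ, 0 ≤ t → HasDerivAt y (-γ • y t + h t) t)
    (hh : ∀ t : ℝ, 0 ≤ t → ‖h t‖ ≤ C) {τ : ℝ} (hτ : 0 ≤ τ) :
    ‖y τ‖ ≤ Real.exp (-γ * τ) * ‖y 0‖ + C / γ := by
  have hexp (t : ℝ) : HasDerivAt (fun s => Real.exp (γ * s)) (Real.exp (γ * t) * γ) t := by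
    simpa using ((hasDerivAt_id t).const_mul γ).exp
  have hg (t : ℝ) (ht : 0 ≤ t) :
      HasDerivAt (fun s => Real.exp (γ * s) • y s) (Real.exp (γ * t) • h t) t := by
    refine ((hexp t).smul (hy t ht)).congr_deriv ?_
    module
  have hB (t : ℝ) : HasDerivAt (fun s => ‖y 0‖ + C / γ * (Real.exp (γ * s) - 1))
      (C * Real.exp (γ * t)) t := by
    refine ((((hexp t).sub_const 1).const_mul (C / γ)).const_add ‖y 0‖).congr_deriv ?_
    field_simp
  have key := image_norm_le_of_norm_deriv_right_le_deriv_boundary (a := 0) (b := τ)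
    (fun t ht => (hg t ht.1).continuousAt.continuousWithinAt)
    (fun t ht => (hg t ht.1).hasDerivWithinAt) (by simp) hB
    (fun t ht => by
      rw [norm_smul, Real.norm_of_nonneg (Real.exp_pos _).le, mul_comm]
      gcongr
      exact hh t ht.1)
    (Set.right_mem_Icc.2 hτ)
  rw [norm_smul, Real.norm_of_nonneg (Real.exp_pos _).le] at key
  have hC : 0 ≤ C / γ := div_nonneg ((norm_nonneg _).trans (hh 0 le_rfl)) hγ.le
  have hinv : Real.exp (-γ * τ) * Real.exp (γ * τ) = 1 := by
    rw [← Real.exp_add]; simp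
  calc ‖y τ‖ = Real.exp (-γ * τ) * (Real.exp (γ * τ) * ‖y τ‖) := by
        rw [← mul_assoc, hinv, one_mul]
    _ ≤ Real.exp (-γ * τ) * (‖y 0‖ + C / γ * (Real.exp (γ * τ) - 1)) := by gcongr
    _ = Real.exp (-γ * τ) * ‖y 0‖ + C / γ * (1 - Real.exp (-γ * τ)) := by
        linear_combination C / γ * hinv
    _ ≤ Real.exp (-γ * τ) * ‖y 0‖ + C / γ := by
        nlinarith [mul_nonneg hC (Real.exp_pos (-γ * τ)).le]

/-- Quasistationary approximation. Let `γ > 0`, let `f` be continuously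
differentiable on `[0,∞)` with `‖f'(s)‖ ≤ Λ` there, and let `x` solve
`x' = −γ x + f` on `[0,∞)`. Then for every `τ ≥ 0`,
`‖x(τ) − f(τ)/γ‖ ≤ e^{−γτ} ‖x(0) − f(0)/γ‖ + Λ/γ²`. -/
theorem stmt_12 (γ Λ : ℝ) (hγ : 0 < γ) (f f' x : ℝ → ℂ)
    (hf : ∀ s : ℝ, 0 ≤ s → HasDerivAt f (f' s) s)
    (hf'cont : ContinuousOn f' (Set.Ici 0))
    (hf'bound : ∀ s : ℝ, 0 ≤ s → ‖f' s‖ ≤ Λ)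
    (hx : ∀ τ : ℝ, 0 ≤ τ → HasDerivAt x (-(γ : ℂ) * x τ + f τ) τ) :
    ∀ τ : ℝ, 0 ≤ τ →
      ‖x τ - f τ / (γ : ℂ)‖ ≤ Real.exp (-γ * τ) * ‖x 0 - f 0 / (γ : ℂ)‖ + Λ / γ ^ 2 := by
  intro τ hτ
  have hγ' : (γ : ℂ) ≠ 0 := by exact_mod_cast hγ.ne'
  have hy (t : ℝ) (ht : 0 ≤ t) : HasDerivAt (fun s => x s - f s / (γ : ℂ))
      (-γ • (x t - f t / (γ : ℂ)) + -(f' t / (γ : ℂ))) t := by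
    refine ((hx t ht).sub ((hf t ht).div_const (γ : ℂ))).congr_deriv ?_
    rw [Complex.real_smul]
    push_cast
    field_simp
    ring
  have hbound (t : ℝ) (ht : 0 ≤ t) : ‖-(f' t / (γ : ℂ))‖ ≤ Λ / γ := by
    rw [norm_neg, norm_div, Complex.norm_of_nonneg hγ.le]
    gcongr
    exact hf'bound t ht
  have key := norm_le_exp_mul_add_of_hasDerivAt_damped hγ hy hbound hτ
  rwa [div_div, ← sq] at key
end

section
/- Let k > 0, let α ∈ ℝ, and let G : (0,∞)^4 → [0,∞] be measurable and homogeneous of degree α, i.e. G(λa, λb, λc, λe) = λ^α G(a,b,c,e) for all λ > 0 and a,b,c,e > 0. Then ∫_{(0,∞)³} G(k_1, k_2, k_3, k) dk_1 dk_2 dk_3 = ∫_{(0,∞)³} (k/k_3)^{α+4} G(k_1, k_2, k, k_3) dk_1 dk_2 dk_3 (as Lebesgue integrals with values in [0,∞]). (This is the Zakharov transformation identity: substituting k_1 ↦ k k_1/k_3, k_2 ↦ k k_2/k_3, k_3 ↦ k²/k_3 swaps the roles of the third and fourth arguments of G and produces the homogeneity factor (k/k_3)^{α+4}.) -/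
open MeasureTheory
open scoped ENNReal

/-- Rescaling the half-line by a positive factor. -/
lemma lintegral_Ioi_zero_comp_mul_left {c : ℝ} (hc : 0 < c) (f : ℝ → ℝ≥0∞) :
    ∫⁻ x in Set.Ioi (0 : ℝ), f x =
      ENNReal.ofReal c * ∫⁻ x in Set.Ioi (0 : ℝ), f (c * x) := by
  have himg : (fun x : ℝ => c * x) '' Set.Ioi 0 = Set.Ioi 0 := by
    ext y
    constructor
    · rintro ⟨x, hx, rfl⟩
      exact mul_pos hc hx
    · intro hy
      exact ⟨y / c, div_pos hy hc, by field_simp⟩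
  have h := lintegral_image_eq_lintegral_abs_deriv_mul (s := Set.Ioi 0)
    (f := fun x : ℝ => c * x)
    (f' := fun _ => c) measurableSet_Ioi
    (fun x _ => by simpa using ((hasDerivAt_id x).const_mul c).hasDerivWithinAt)
    (fun x _ y _ hxy => mul_left_cancel₀ hc.ne' hxy) f
  rw [himg] at h
  rw [h, abs_of_pos hc, lintegral_const_mul' _ _ ENNReal.ofReal_ne_top]

/-- The inversion `x ↦ c / x` of the half-line. -/
lemma lintegral_Ioi_zero_comp_const_div {c : ℝ} (hc : 0 < c) (f : ℝ → ℝ≥0∞) :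
    ∫⁻ x in Set.Ioi (0 : ℝ), f x =
      ∫⁻ x in Set.Ioi (0 : ℝ), ENNReal.ofReal (c / x ^ 2) * f (c / x) := by
  have himg : (fun x : ℝ => c / x) '' Set.Ioi 0 = Set.Ioi 0 := by
    ext y
    constructor
    · rintro ⟨x, hx, rfl⟩
      exact div_pos hc hx
    · intro hy
      have hy' : y ≠ 0 := ne_of_gt hy
      exact ⟨c / y, div_pos hc hy, by field_simp⟩
  have hderiv : ∀ x ∈ Set.Ioi (0 : ℝ),
      HasDerivWithinAt (fun x : ℝ => c / x) (-(c / x ^ 2)) (Set.Ioi 0) x := by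
    intro x hx
    have h := ((hasDerivAt_inv (ne_of_gt hx)).const_mul c).hasDerivWithinAt (s := Set.Ioi 0)
    simpa [div_eq_mul_inv] using h
  have hinj : Set.InjOn (fun x : ℝ => c / x) (Set.Ioi 0) := by
    intro x _ y _ hxy
    simpa [div_eq_mul_inv, hc.ne'] using hxy
  have h := lintegral_image_eq_lintegral_abs_deriv_mul measurableSet_Ioi hderiv hinj f
  rw [himg] at h
  rw [h]
  refine setLIntegral_congr_fun measurableSet_Ioi fun x hx => ?_
  have hx : 0 < x := hx
  simp only [abs_neg]
  rw [abs_of_pos (by positivity)]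

/-- Tonelli's theorem on the positive octant, with the last coordinate integrated last. -/
lemma setLIntegral_octant_eq_iterated {F : ℝ × ℝ × ℝ → ℝ≥0∞} (hF : Measurable F) :
    ∫⁻ p in Set.Ioi (0 : ℝ) ×ˢ Set.Ioi (0 : ℝ) ×ˢ Set.Ioi (0 : ℝ), F p =
      ∫⁻ z in Set.Ioi (0 : ℝ), ∫⁻ y in Set.Ioi (0 : ℝ), ∫⁻ x in Set.Ioi (0 : ℝ),
        F (x, y, z) := by
  rw [Measure.volume_eq_prod, Measure.volume_eq_prod, ← Measure.prod_restrict,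
    ← Measure.prod_restrict, lintegral_prod_symm' _ hF,
    lintegral_prod_symm' _ hF.lintegral_prod_left']

/-- Zakharov transformation identity. If `G : (0,∞)⁴ → [0,∞]` is measurable
and homogeneous of degree `α`, then for `k > 0`,
`∫_{(0,∞)³} G(k₁,k₂,k₃,k) dk₁dk₂dk₃ = ∫_{(0,∞)³} (k/k₃)^{α+4} G(k₁,k₂,k,k₃) dk₁dk₂dk₃`. -/
theorem stmt_14 (k α : ℝ) (hk : 0 < k) (G : ℝ → ℝ → ℝ → ℝ → ℝ≥0∞)
    (hGmeas : Measurable (fun p : ℝ × ℝ × ℝ × ℝ => G p.1 p.2.1 p.2.2.1 p.2.2.2))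
    (hGhom : ∀ l a b c e : ℝ, 0 < l → 0 < a → 0 < b → 0 < c → 0 < e →
      G (l * a) (l * b) (l * c) (l * e) = ENNReal.ofReal (l ^ α) * G a b c e) :
    ∫⁻ p in Set.Ioi (0 : ℝ) ×ˢ Set.Ioi (0 : ℝ) ×ˢ Set.Ioi (0 : ℝ), G p.1 p.2.1 p.2.2 k =
      ∫⁻ p in Set.Ioi (0 : ℝ) ×ˢ Set.Ioi (0 : ℝ) ×ˢ Set.Ioi (0 : ℝ),
        ENNReal.ofReal ((k / p.2.2) ^ (α + 4)) * G p.1 p.2.1 k p.2.2 := by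
  rw [setLIntegral_octant_eq_iterated (F := fun p => G p.1 p.2.1 p.2.2 k)
      (hGmeas.comp (f := fun p : ℝ × ℝ × ℝ => (p.1, p.2.1, p.2.2, k)) (by fun_prop)),
    setLIntegral_octant_eq_iterated
      (F := fun p => ENNReal.ofReal ((k / p.2.2) ^ (α + 4)) * G p.1 p.2.1 k p.2.2)
      (Measurable.mul (by fun_prop)
        (hGmeas.comp (f := fun p : ℝ × ℝ × ℝ => (p.1, p.2.1, k, p.2.2)) (by fun_prop))),
    lintegral_Ioi_zero_comp_const_div (pow_pos hk 2)]
  refine setLIntegral_congr_fun measurableSet_Ioi fun z (hz : 0 < z) => ?_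
  have hl : 0 < k / z := div_pos hk hz
  simp only
  rw [lintegral_Ioi_zero_comp_mul_left hl, ← lintegral_const_mul' _ _ ENNReal.ofReal_ne_top,
    ← lintegral_const_mul' _ _ ENNReal.ofReal_ne_top]
  refine setLIntegral_congr_fun measurableSet_Ioi fun y (hy : 0 < y) => ?_
  rw [lintegral_Ioi_zero_comp_mul_left hl, ← lintegral_const_mul' _ _ ENNReal.ofReal_ne_top,
    ← lintegral_const_mul' _ _ ENNReal.ofReal_ne_top,
    ← lintegral_const_mul' _ _ ENNReal.ofReal_ne_top]
  refine setLIntegral_congr_fun measurableSet_Ioi fun x (hx : 0 < x) => ?_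
  have hG := hGhom (k / z) x y k z hl hx hy hk hz
  rw [show k / z * k = k ^ 2 / z by ring, div_mul_cancel₀ k hz.ne'] at hG
  rw [hG, ← mul_assoc, ← mul_assoc, ← mul_assoc, ← ENNReal.ofReal_mul (by positivity),
    ← ENNReal.ofReal_mul (by positivity), ← ENNReal.ofReal_mul (by positivity),
    Real.rpow_add hl, show (4 : ℝ) = ((4 : ℕ) : ℝ) by norm_num, Real.rpow_natCast]
  congr 2
  ring
end
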